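/- For Lebesgue-almost every configuration of points (θ_1,…,θ_n) ∈ (ℝ^d)^n with n ≥ d+1, and for every realizable ranking σ, the following holds: for every set A of pairwise comparisons with |A| < d, there exists a realizable ranking σ' ≠ σ that agrees with σ on every comparison in A. Consequently, no fewer than d pairwise-comparison answers can uniquely determine any realizable ranking. -/

import Mathlib

open MeasureTheory

/-- `i` precedes `j` in the ranking `σ` (a permutation sending rank positions to objects). -/
def Precedes {n : ℕ} (σ : Equiv.Perm (Fin n)) (i j : Fin n) : Prop := σ.symm i < σ.symm j

/-- Realizable rankings of the configuration `θ`. -/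
def realizableRankings {n d : ℕ} (θ : Fin n → EuclideanSpace ℝ (Fin d)) :
    Set (Equiv.Perm (Fin n)) :=
  {σ | ∃ r : EuclideanSpace ℝ (Fin d),
    ∀ i j : Fin n, Precedes σ i j ↔ dist (θ i) r < dist (θ j) r}

/-- Two rankings agree on the pairwise comparison given by the unordered pair `p`. -/
def AgreeOnPair {n : ℕ} (σ σ' : Equiv.Perm (Fin n)) (p : Sym2 (Fin n)) : Prop :=
  ∀ i j : Fin n, p = s(i, j) → (Precedes σ i j ↔ Precedes σ' i j)

open Filter in
/-- Distinct affine functions differ at all large enough arguments. -/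
theorem eventually_affine_ne {a a' b b' : ℝ} (h : a ≠ a') :
    ∀ᶠ t : ℝ in atTop, a - 2 * t * b ≠ a' - 2 * t * b' := by
  rcases eq_or_ne b b' with rfl | hb
  · exact Eventually.of_forall fun t ht => h (by linarith)
  · filter_upwards [eventually_ne_atTop ((a - a') / (2 * (b - b')))] with t ht heq
    have hb' : b - b' ≠ 0 := sub_ne_zero.2 hb
    exact ht (by field_simp; linarith)

/-- An injective real-valued function on `Fin n` is the rank order of some permutation. -/
theorem exists_perm_precedes_iff {n : ℕ} {g : Fin n → ℝ} (hg : Function.Injective g) :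
    ∃ σ : Equiv.Perm (Fin n), ∀ i j, Precedes σ i j ↔ g i < g j := by
  have hmono : StrictMono (g ∘ Tuple.sort g) :=
    (Tuple.monotone_sort g).strictMono_of_injective (hg.comp (Tuple.sort g).injective)
  refine ⟨Tuple.sort g, fun i j => ?_⟩
  simpa [Precedes] using
    (hmono.lt_iff_lt (a := (Tuple.sort g).symm i) (b := (Tuple.sort g).symm j)).symm

/-- The matrix whose rows are the differences `θ (k + 1) - θ 0` for `k < d`. -/
def differenceMatrix {n d : ℕ} (hn : d + 1 ≤ n) (θ : Fin n → EuclideanSpace ℝ (Fin d)) :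
    Matrix (Fin d) (Fin d) ℝ :=
  Matrix.of fun k l => θ (Fin.castLE hn k.succ) l - θ (Fin.castLE hn 0) l

/-- Almost every configuration has an invertible difference matrix. -/
theorem ae_det_differenceMatrix_ne_zero {n d : ℕ} (hn : d + 1 ≤ n) :
    ∀ᵐ θ : Fin n → EuclideanSpace ℝ (Fin d) ∂volume, (differenceMatrix hn θ).det ≠ 0 := by
  let simplex : Fin n → EuclideanSpace ℝ (Fin d) := fun i =>
    WithLp.toLp 2 fun l => if (i : ℕ) = l + 1 then 1 else 0
  have hcont : Continuous fun θ : Fin n → EuclideanSpace ℝ (Fin d) =>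
      (differenceMatrix hn θ).det := by
    refine Continuous.matrix_det ?_
    refine continuous_matrix fun k l => ?_
    simp only [differenceMatrix, Matrix.of_apply]
    fun_prop
  refine ae_mem_of_ae_add_linearMap_mem (LinearMap.toSpanSingleton ℝ _ simplex) volume volume
    (s := {θ | (differenceMatrix hn θ).det ≠ 0})
    (isOpen_ne_fun hcont continuous_const).measurableSet fun θ => ?_
  have hadd : ∀ t : ℝ, differenceMatrix hn (θ + t • simplex) =
      Matrix.scalar (Fin d) t - -differenceMatrix hn θ := by
    intro t
    ext k l
    simp only [differenceMatrix, simplex, Matrix.of_apply, Matrix.sub_apply, Matrix.neg_apply,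
      Matrix.scalar_apply, Matrix.diagonal_apply, Pi.add_apply, Pi.smul_apply, PiLp.add_apply,
      PiLp.smul_apply, smul_eq_mul, Fin.val_castLE, Fin.val_succ, Fin.val_zero, Fin.ext_iff,
      Nat.add_right_cancel_iff]
    split_ifs <;> first | contradiction | ring
  have hroots : {t : ℝ | (-differenceMatrix hn θ).charpoly.IsRoot t}.Finite :=
    Polynomial.finite_setOfPred_isRoot (Matrix.charpoly_monic _).ne_zero
  filter_upwards [compl_mem_ae_iff.2 (hroots.measure_zero volume)] with t ht
  simpa [hadd, Matrix.eval_charpoly, Polynomial.IsRoot] using ht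

/-- A nonzero vector fails to be orthogonal to some difference of points. -/
theorem exists_inner_ne_of_det_ne_zero {n d : ℕ} {hn : d + 1 ≤ n}
    {θ : Fin n → EuclideanSpace ℝ (Fin d)} (hθ : (differenceMatrix hn θ).det ≠ 0)
    {v : EuclideanSpace ℝ (Fin d)} (hv : v ≠ 0) :
    ∃ i j, inner ℝ v (θ i) ≠ inner ℝ v (θ j) := by
  by_contra! h
  refine hv ((WithLp.ofLp_injective 2) (Matrix.eq_zero_of_mulVec_eq_zero hθ ?_))
  ext k
  have := h (Fin.castLE hn k.succ) (Fin.castLE hn 0)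
  simp only [PiLp.inner_apply, RCLike.inner_apply, conj_trivial] at this
  simp [Matrix.mulVec, dotProduct, differenceMatrix, sub_mul, Finset.sum_sub_distrib, this]

/-- Fewer than `d` pairs admit a nonzero vector orthogonal to all their differences. -/
theorem exists_ne_zero_inner_eq {n d : ℕ} (θ : Fin n → EuclideanSpace ℝ (Fin d))
    {A : Finset (Sym2 (Fin n))} (hA : A.card < d) :
    ∃ v ≠ 0, ∀ i j, s(i, j) ∈ A → inner ℝ v (θ i) = inner ℝ v (θ j) := by
  let L : EuclideanSpace ℝ (Fin d) →ₗ[ℝ] (A → ℝ) := LinearMap.pi fun p =>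
    (innerₗ _ (θ (Quot.out p.1).1 - θ (Quot.out p.1).2))
  have hker : LinearMap.ker L ≠ ⊥ := LinearMap.ker_ne_bot_of_finrank_lt (by simpa using hA)
  obtain ⟨v, hv, hv0⟩ := (Submodule.ne_bot_iff _).1 hker
  refine ⟨v, hv0, fun i j hij => ?_⟩
  have hp := congrFun (LinearMap.mem_ker.1 hv) ⟨s(i, j), hij⟩
  simp only [L, LinearMap.pi_apply, innerₗ_apply_apply, Pi.zero_apply] at hp
  rw [real_inner_comm, inner_sub_right, sub_eq_zero] at hp
  have hout : s((Quot.out s(i, j)).1, (Quot.out s(i, j)).2) = s(i, j) := Quot.out_eq s(i, j)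
  rcases Sym2.eq_iff.1 hout with ⟨h₁, h₂⟩ | ⟨h₁, h₂⟩
  · rwa [h₁, h₂] at hp
  · rw [h₁, h₂] at hp
    exact hp.symm

theorem dist_lt_dist_add_smul_iff {E : Type*} [NormedAddCommGroup E] [InnerProductSpace ℝ E]
    (x y r v : E) (t : ℝ) :
    dist x (r + t • v) < dist y (r + t • v) ↔
      dist x r ^ 2 - 2 * t * inner ℝ v x < dist y r ^ 2 - 2 * t * inner ℝ v y := by
  have key : ∀ z : E, dist z (r + t • v) ^ 2 =
      dist z r ^ 2 - 2 * t * inner ℝ v z + (2 * t * inner ℝ v r + ‖t • v‖ ^ 2) := by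
    intro z
    rw [dist_eq_norm, dist_eq_norm, ← sub_sub, norm_sub_sq_real, real_inner_smul_right,
      real_inner_comm, inner_sub_right]
    ring
  rw [← pow_lt_pow_iff_left₀ dist_nonneg dist_nonneg two_ne_zero, key, key, add_lt_add_iff_right]

open Filter in
/-- Moving the reference point along a direction that separates two objects, and that is
orthogonal to the differences of the pairs in `A`, produces a new ranking. -/
theorem exists_realizable_ne_of_inner_lt {n d : ℕ} {θ : Fin n → EuclideanSpace ℝ (Fin d)}
    {σ : Equiv.Perm (Fin n)} (hσ : σ ∈ realizableRankings θ) {A : Finset (Sym2 (Fin n))}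
    {v : EuclideanSpace ℝ (Fin d)}
    (hv : ∀ i j, s(i, j) ∈ A → inner ℝ v (θ i) = inner ℝ v (θ j))
    {i j : Fin n} (hij : Precedes σ i j) (hlt : inner ℝ v (θ i) < inner ℝ v (θ j)) :
    ∃ σ' ∈ realizableRankings θ, σ' ≠ σ ∧ ∀ p ∈ A, AgreeOnPair σ σ' p := by
  obtain ⟨r, hr⟩ := hσ
  have hne : ∀ k l, k ≠ l → dist (θ k) r ^ 2 ≠ dist (θ l) r ^ 2 := by
    intro k l hkl h
    have h' := (pow_left_inj₀ dist_nonneg dist_nonneg two_ne_zero).1 h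
    rcases (σ.symm.injective.ne hkl).lt_or_gt with h₁ | h₁
    · exact ((hr k l).1 h₁).ne h'
    · exact ((hr l k).1 h₁).ne' h'
  have hinj : ∀ᶠ t : ℝ in atTop, ∀ k l, k ≠ l → dist (θ k) r ^ 2 - 2 * t * inner ℝ v (θ k) ≠
      dist (θ l) r ^ 2 - 2 * t * inner ℝ v (θ l) := by
    simp only [eventually_all]
    exact fun k l hkl => eventually_affine_ne (hne k l hkl)
  obtain ⟨t, ht, hflip⟩ := (hinj.and (eventually_gt_atTop
    ((dist (θ j) r ^ 2 - dist (θ i) r ^ 2) /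
      (2 * (inner ℝ v (θ j) - inner ℝ v (θ i)))))).exists
  obtain ⟨σ', hσ'⟩ := exists_perm_precedes_iff
    (g := fun k => dist (θ k) r ^ 2 - 2 * t * inner ℝ v (θ k))
    fun k l hkl => by_contra fun hne' => ht k l hne' hkl
  refine ⟨σ', ⟨r + t • v, fun k l => ?_⟩, ?_, ?_⟩
  · rw [hσ', dist_lt_dist_add_smul_iff]
  · rintro rfl
    have h := (hσ' i j).1 hij
    rw [div_lt_iff₀ (by linarith)] at hflip
    linarith
  · rintro p hp k l rfl
    rw [hr, hσ', hv k l hp, sub_lt_sub_iff_right,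
      pow_lt_pow_iff_left₀ dist_nonneg dist_nonneg two_ne_zero]

/-- for Lebesgue-a.e. configuration of `n ≥ d+1` points in `ℝ^d`, for every
realizable ranking `σ` and every set `A` of fewer than `d` pairwise comparisons, some
realizable ranking `σ' ≠ σ` agrees with `σ` on every comparison in `A`. -/
theorem stmt_7 (n d : ℕ) (hd : 1 ≤ d) (hn : d + 1 ≤ n) :
    ∀ᵐ θ : Fin n → EuclideanSpace ℝ (Fin d) ∂volume,
      ∀ σ ∈ realizableRankings θ,
        ∀ A : Finset (Sym2 (Fin n)), A.card < d →
          ∃ σ' ∈ realizableRankings θ, σ' ≠ σ ∧ ∀ p ∈ A, AgreeOnPair σ σ' p := by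
  filter_upwards [ae_det_differenceMatrix_ne_zero hn] with θ hθ σ hσ A hA
  obtain ⟨v, hv0, hv⟩ := exists_ne_zero_inner_eq θ hA
  obtain ⟨i, j, hij, hprec⟩ :
      ∃ i j, inner ℝ v (θ i) ≠ inner ℝ v (θ j) ∧ Precedes σ i j := by
    obtain ⟨i, j, hij⟩ := exists_inner_ne_of_det_ne_zero hθ hv0
    have hne : i ≠ j := fun h => hij (by rw [h])
    rcases (σ.symm.injective.ne hne).lt_or_gt with h | h
    · exact ⟨i, j, hij, h⟩
    · exact ⟨j, i, hij.symm, h⟩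
  rcases hij.lt_or_gt with h | h
  · exact exists_realizable_ne_of_inner_lt hσ hv hprec h
  · exact exists_realizable_ne_of_inner_lt hσ (v := -v)
      (fun k l hkl => by simpa only [inner_neg_left, neg_inj] using hv k l hkl) hprec
      (by simpa only [inner_neg_left, neg_lt_neg_iff] using h)
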